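/- arXiv:2504.01107 — 2 statements merged into one kernel-verified Lean document; each statement's English description precedes it below -/
import Mathlib

section
/- Let γ = γ_{m₁,…,m_r} ∈ S_m and σ ∈ S_NC(m₁,…,m_r). Let M ⊆ [m] meet every cycle of γ. If σ|_M ∨ γ|_M = 1_M, then σ|_M ∈ S_NC(γ|_M). -/
open Equiv

namespace ThirdOrderFree

variable {α : Type*}

/-- The setoid whose classes are the cycles (orbits) of a permutation. -/
def sameCycleSetoid (σ : Perm α) : Setoid α :=
  ⟨σ.SameCycle,
    ⟨fun x => Equiv.Perm.SameCycle.refl σ x, fun h => h.symm, fun h h' => h.trans h'⟩⟩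

/-- Number of cycles (orbits, including fixed points) of a permutation. -/
noncomputable def numCycles (σ : Perm α) : ℕ :=
  Nat.card (Quotient (sameCycleSetoid σ))

/-- The length `|σ| = n - #(σ)`. -/
noncomputable def len (σ : Perm α) : ℕ :=
  Nat.card α - numCycles σ

/-- Join of the cycle partitions of two permutations. -/
def joinSetoid (π σ : Perm α) : Setoid α :=
  sameCycleSetoid π ⊔ sameCycleSetoid σ

/-- Number of blocks of `π ∨ σ`. -/
noncomputable def numBlocks (π σ : Perm α) : ℕ :=
  Nat.card (Quotient (joinSetoid π σ))

/-- `π ∨ σ` is the one-block partition. -/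
def JoinTop (π σ : Perm α) : Prop :=
  ∀ x y : α, (joinSetoid π σ).r x y

/-- `π` is a non-crossing (annular) permutation with respect to `γ`. -/
def SNC (γ π : Perm α) : Prop :=
  JoinTop π γ ∧
    numCycles π + numCycles (π⁻¹ * γ) + numCycles γ = Nat.card α + 2

/-- `τ` separates the points of `N`: no cycle of `τ` contains two distinct points of `N`. -/
def Separates (τ : Perm α) (N : Set α) : Prop :=
  ∀ x ∈ N, ∀ y ∈ N, τ.SameCycle x y → x = y

/-- The first-return map of `σ` on the set `{x | p x}`. -/
noncomputable def firstReturn (σ : Perm α) (p : α → Prop) (x : α) : α :=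
  (σ ^ sInf {k : ℕ | 0 < k ∧ p ((σ ^ k) x)}) x

open Classical in
/-- The restriction of `σ` to `{x | p x}`: the unique permutation agreeing with the
first-return map (it exists whenever `α` is finite). -/
noncomputable def restrictPerm (σ : Perm α) (p : α → Prop) : Perm {x // p x} :=
  if h : ∃ e : Perm {x // p x}, ∀ x : {x // p x}, (e x : α) = firstReturn σ p (x : α)
  then h.choose else 1

/-- `π ≤ σ` : each cycle of `π` is contained in a cycle of `σ` and on each cycle of
`σ` the restriction of `π` is a non-crossing permutation of that cycle. -/
def le' (π σ : Perm α) : Prop :=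
  (∀ x y : α, π.SameCycle x y → σ.SameCycle x y) ∧
  ∀ x : α,
    numCycles (restrictPerm π (σ.SameCycle x)) +
      numCycles ((restrictPerm π (σ.SameCycle x))⁻¹ * restrictPerm σ (σ.SameCycle x)) =
      Nat.card {y // σ.SameCycle x y} + 1

/-- `π ≲ σ` : on each block of `π ∨ σ`, `π` is annular non-crossing w.r.t. `σ`. -/
def ncRel (π σ : Perm α) : Prop :=
  ∀ x : α,
    SNC (restrictPerm σ ((joinSetoid π σ).r x)) (restrictPerm π ((joinSetoid π σ).r x))

/-- The permutation of `Σ i, Fin (n i)` rotating each block: the product of the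
directed cycles `T i` of lengths `n i`. -/
def blockRotate {ι : Type*} (n : ι → ℕ) : Perm ((i : ι) × Fin (n i)) :=
  Equiv.sigmaCongrRight fun i => finRotate (n i)

/-- The first elements of the blocks. -/
def zeroSection {ι : Type*} (n : ι → ℕ) (hn : ∀ i, 0 < n i) :
    ι ≃ {x : (i : ι) × Fin (n i) // x.2.val = 0} where
  toFun i := ⟨⟨i, ⟨0, hn i⟩⟩, rfl⟩
  invFun x := x.1.1
  left_inv i := rfl
  right_inv := fun x => by
    obtain ⟨⟨i, j⟩, hj⟩ := x
    exact Subtype.ext (congrArg (Sigma.mk i) (Fin.ext hj.symm))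

/-- `π_{\vec n}` : merge the blocks `T i` along the cycles of `π`; within a block it
moves forward, and the last element of block `i` is sent to the first element of
block `π i`. -/
def mergePerm {ι : Type*} (n : ι → ℕ) (hn : ∀ i, 0 < n i) (π : Perm ι) :
    Perm ((i : ι) × Fin (n i)) :=
  (π.extendDomain (zeroSection n hn)) * blockRotate n


section Aux

theorem sameCycleSetoid_le {τ : Perm α} {R : Setoid α} (h : ∀ z, R.r (τ z) z) :
    sameCycleSetoid τ ≤ R := by
  have hn : ∀ (n : ℕ) (z : α), R.r ((τ ^ n) z) z := by
    intro n
    induction n with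
    | zero => intro z; exact R.refl z
    | succ n ih =>
      intro z
      rw [pow_succ', Perm.mul_apply]
      exact R.trans (h _) (ih z)
  intro a b hab
  obtain ⟨i, hi⟩ := hab
  subst hi
  obtain ⟨n, rfl | rfl⟩ := i.eq_nat_or_neg
  · rw [zpow_natCast]; exact R.symm (hn n a)
  · have := hn n ((τ ^ (-(n : ℤ))) a)
    rw [zpow_neg, zpow_natCast, show (τ ^ n) ((τ ^ n)⁻¹ a) = a from Equiv.apply_symm_apply _ _] at this
    rw [zpow_neg, zpow_natCast]; exact this

theorem sameCycle_apply_self (τ : Perm α) (z : α) : (sameCycleSetoid τ).r (τ z) z :=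
  Perm.SameCycle.symm ⟨1, by simp⟩

theorem join_le {π γ : Perm α} {R : Setoid α} (h : ∀ z, R.r (π z) z) (h' : ∀ z, R.r (γ z) z) :
    joinSetoid π γ ≤ R :=
  sup_le (sameCycleSetoid_le h) (sameCycleSetoid_le h')

theorem join_left (π γ : Perm α) (z : α) : (joinSetoid π γ).r (π z) z :=
  (le_sup_left : sameCycleSetoid π ≤ joinSetoid π γ) (sameCycle_apply_self π z)

theorem join_right (π γ : Perm α) (z : α) : (joinSetoid π γ).r (γ z) z :=
  (le_sup_right : sameCycleSetoid γ ≤ joinSetoid π γ) (sameCycle_apply_self γ z)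

theorem card_antitone [Finite α] {r s : Setoid α} (h : r ≤ s) :
    Nat.card (Quotient s) ≤ Nat.card (Quotient r) := by
  refine Nat.card_le_card_of_surjective (Quotient.map' id h) ?_
  intro q
  induction q using Quotient.inductionOn with
  | h a => exact ⟨Quotient.mk _ a, rfl⟩

open Classical in
noncomputable def mergeFun (r : Setoid α) (x y z : α) : Quotient r :=
  if (Quotient.mk r z) = Quotient.mk r y then Quotient.mk r x else Quotient.mk r z

noncomputable def merge (r : Setoid α) (x y : α) : Setoid α := Setoid.ker (mergeFun r x y)

theorem le_merge (r : Setoid α) (x y : α) : r ≤ merge r x y := by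
  intro a b h
  have : Quotient.mk r a = Quotient.mk r b := Quotient.sound h
  show mergeFun r x y a = mergeFun r x y b
  unfold mergeFun
  rw [this]

theorem merge_xy (r : Setoid α) (x y : α) : (merge r x y).r x y := by
  show mergeFun r x y x = mergeFun r x y y
  simp only [mergeFun]
  split_ifs <;> simp_all

theorem merge_le {r R : Setoid α} {x y : α} (h : r ≤ R) (hxy : R.r x y) : merge r x y ≤ R := by
  intro a b hab
  have hab : mergeFun r x y a = mergeFun r x y b := hab
  simp only [mergeFun] at hab
  split_ifs at hab with h1 h2 h2
  · exact R.trans (h (Quotient.exact h1)) (R.symm (h (Quotient.exact h2)))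
  · exact R.trans (h (Quotient.exact h1)) (R.trans (R.symm hxy) (h (Quotient.exact hab)))
  · exact R.trans (h (Quotient.exact hab)) (R.trans hxy (R.symm (h (Quotient.exact h2))))
  · exact h (Quotient.exact hab)

theorem card_merge (r : Setoid α) (x y : α) :
    Nat.card (Quotient (merge r x y)) = (Set.range (mergeFun r x y)).ncard :=
  Nat.card_congr (Setoid.quotientKerEquivRange _)

theorem card_le_merge [Finite α] (r : Setoid α) (x y : α) :
    Nat.card (Quotient r) ≤ Nat.card (Quotient (merge r x y)) + 1 := by
  rw [card_merge]
  have h : (Set.univ : Set (Quotient r)) ⊆ insert (Quotient.mk r y) (Set.range (mergeFun r x y)) := by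
    intro q _
    induction q using Quotient.inductionOn with
    | h a =>
      by_cases ha : Quotient.mk r a = Quotient.mk r y
      · left; exact ha
      · right; exact ⟨a, by simp [mergeFun, ha]⟩
  rw [← Set.ncard_univ]
  exact (Set.ncard_le_ncard h).trans (Set.ncard_insert_le _ _)

theorem card_merge_lt [Finite α] (r : Setoid α) (x y : α) (hxy : ¬ r.r x y) :
    Nat.card (Quotient (merge r x y)) + 1 ≤ Nat.card (Quotient r) := by
  rw [card_merge, ← Set.ncard_univ]
  refine Set.ncard_lt_ncard ?_
  refine (Set.ssubset_univ_iff).2 fun h => ?_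
  have : Quotient.mk r y ∈ Set.range (mergeFun r x y) := h ▸ Set.mem_univ _
  obtain ⟨z, hz⟩ := this
  simp only [mergeFun] at hz
  split_ifs at hz with h1
  · exact hxy (Quotient.exact hz)
  · exact h1 hz

theorem swap_rel [DecidableEq α] {R : Setoid α} {x y : α} (h : R.r x y) (z : α) :
    R.r (swap x y z) z := by
  by_cases hx : z = x
  · subst hx; rw [swap_apply_left]; exact R.symm h
  by_cases hy : z = y
  · subst hy; rw [swap_apply_right]; exact h
  rw [swap_apply_of_ne_of_ne hx hy]

theorem mul_rel {R : Setoid α} {σ τ : Perm α} (h : ∀ z, R.r (σ z) z) (h' : ∀ z, R.r (τ z) z)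
    (z : α) : R.r ((σ * τ) z) z := R.trans (h (τ z)) (h' z)

theorem inv_rel {R : Setoid α} {σ : Perm α} (h : ∀ z, R.r (σ z) z)
    (z : α) : R.r (σ⁻¹ z) z := by
  have := h (σ⁻¹ z)
  rw [show σ (σ⁻¹ z) = z from Equiv.apply_symm_apply _ _] at this
  exact R.symm this

theorem mul_swap_le_merge [DecidableEq α] (τ : Perm α) (x y : α) :
    sameCycleSetoid (τ * swap x y) ≤ merge (sameCycleSetoid τ) x y :=
  sameCycleSetoid_le (mul_rel (fun z => le_merge _ x y (sameCycle_apply_self τ z))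
    (swap_rel (merge_xy _ x y)))

theorem sameCycle_mul_swap [Finite α] [DecidableEq α] (τ : Perm α) (x y : α)
    (h : ¬ τ.SameCycle x y) : (τ * swap x y).SameCycle x y := by
  have key : ∀ j : ℕ, (τ * swap x y).SameCycle x y ∨
      ((τ * swap x y) ^ (j + 1)) x = (τ ^ (j + 1)) y := by
    intro j
    induction j with
    | zero => right; simp
    | succ j ih =>
      rcases ih with ih | ih
      · left; exact ih
      by_cases hy : (τ ^ (j + 1)) y = y
      · left; exact ⟨(j + 1 : ℕ), by rw [zpow_natCast, ih, hy]⟩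
      by_cases hx : (τ ^ (j + 1)) y = x
      · exact absurd (Perm.SameCycle.symm ⟨(j + 1 : ℕ), by rw [zpow_natCast, hx]⟩) h
      right
      rw [pow_succ', Perm.mul_apply, ih, Perm.mul_apply, swap_apply_of_ne_of_ne hx hy,
        pow_succ' τ (j + 1), Perm.mul_apply]
  have hpos : 0 < orderOf τ := orderOf_pos τ
  rcases key (orderOf τ - 1) with h1 | h1
  · exact h1
  · rw [Nat.sub_add_cancel hpos, pow_orderOf_eq_one] at h1
    exact ⟨(orderOf τ : ℕ), by rw [zpow_natCast, h1]; rfl⟩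

theorem numCycles_le [Finite α] [DecidableEq α] (τ : Perm α) (x y : α) :
    numCycles τ ≤ numCycles (τ * swap x y) + 1 :=
  (card_le_merge _ x y).trans (Nat.add_le_add_right (card_antitone (mul_swap_le_merge τ x y)) 1)

theorem numCycles_merge [Finite α] [DecidableEq α] (τ : Perm α) (x y : α)
    (h : ¬ τ.SameCycle x y) : numCycles (τ * swap x y) + 1 = numCycles τ := by
  have hm : sameCycleSetoid (τ * swap x y) = merge (sameCycleSetoid τ) x y := by
    refine le_antisymm (mul_swap_le_merge τ x y) (merge_le ?_ (sameCycle_mul_swap τ x y h))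
    refine sameCycleSetoid_le fun z => ?_
    have := mul_rel (sameCycle_apply_self (τ * swap x y)) (swap_rel (sameCycle_mul_swap τ x y h)) z
    simpa [mul_assoc] using this
  have h1 := card_le_merge (sameCycleSetoid τ) x y
  have h2 := card_merge_lt (sameCycleSetoid τ) x y h
  unfold numCycles
  rw [hm]
  omega

theorem sameCycleSetoid_inv (τ : Perm α) : sameCycleSetoid τ⁻¹ = sameCycleSetoid τ := by
  ext a b
  exact Perm.sameCycle_inv

theorem numCycles_inv (τ : Perm α) : numCycles τ⁻¹ = numCycles τ := by
  unfold numCycles; rw [sameCycleSetoid_inv]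

theorem numCycles_conj (σ τ : Perm α) : numCycles (σ * τ * σ⁻¹) = numCycles τ := by
  unfold numCycles
  refine (Nat.card_congr (Quotient.congr σ ?_)).symm
  intro a b
  show τ.SameCycle a b ↔ (σ * τ * σ⁻¹).SameCycle (σ a) (σ b)
  rw [Perm.sameCycle_conj]; simp

theorem numCycles_comm (σ τ : Perm α) : numCycles (σ * τ) = numCycles (τ * σ) := by
  rw [← numCycles_conj τ (σ * τ)]; congr 1; group

/-- The genus defect. -/
noncomputable def gdef (π γ : Perm α) : ℤ :=
  Nat.card α + 2 * numBlocks π γ - numCycles π - numCycles (π⁻¹ * γ) - numCycles γ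

theorem gdef_symm (π γ : Perm α) : gdef π γ = gdef γ π := by
  have h1 : numBlocks π γ = numBlocks γ π := by
    unfold numBlocks joinSetoid; rw [sup_comm]
  have h2 : numCycles (π⁻¹ * γ) = numCycles (γ⁻¹ * π) := by
    rw [← numCycles_inv]; simp
  unfold gdef
  rw [h1, h2]; ring

theorem gdef_step [Finite α] [DecidableEq α] (π γ : Perm α) (x : α) :
    gdef (swap x (π x) * π) γ ≤ gdef π γ := by
  by_cases hx : π x = x
  · rw [hx, swap_self]; exact le_of_eq rfl
  set y := π x with hy
  set ρ := swap x y * π with hρ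
  have hπ : π = swap x y * ρ := by rw [hρ, ← mul_assoc, swap_mul_self, one_mul]
  have hρx : ρ x = x := by rw [hρ, Perm.mul_apply, ← hy, swap_apply_right]
  have hns : ¬ ρ.SameCycle x y := by
    intro h
    exact hx ((Perm.SameCycle.eq_of_left h hρx).symm)
  have ha : numCycles π + 1 = numCycles ρ := by
    have := numCycles_merge ρ⁻¹ x y (by rwa [Perm.sameCycle_inv])
    rw [numCycles_inv] at this
    rw [← this, ← numCycles_inv π, hπ, mul_inv_rev, swap_inv]
  have hb1 : numCycles (π⁻¹ * γ) = numCycles (γ * ρ⁻¹ * swap x y) := by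
    rw [numCycles_comm, hπ, mul_inv_rev, swap_inv, mul_assoc]
  have hb2 : numCycles (ρ⁻¹ * γ) = numCycles (γ * ρ⁻¹) := numCycles_comm _ _
  have hτ : sameCycleSetoid (γ * ρ⁻¹) ≤ joinSetoid ρ γ :=
    sameCycleSetoid_le (mul_rel (join_right ρ γ) (inv_rel (join_left ρ γ)))
  have hle : ∀ R : Setoid α, joinSetoid ρ γ ≤ R → R.r x y → joinSetoid π γ ≤ R := by
    intro R h hxy
    refine join_le ?_ fun z => h (join_right ρ γ z)
    rw [hπ]
    exact mul_rel (swap_rel hxy) fun z => h (join_left ρ γ z)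
  by_cases hJ : (joinSetoid ρ γ).r x y
  · have hk : numBlocks ρ γ ≤ numBlocks π γ := card_antitone (hle _ le_rfl hJ)
    have hb := numCycles_le (γ * ρ⁻¹ * swap x y) x y
    rw [mul_assoc (γ * ρ⁻¹), swap_mul_self, mul_one] at hb
    unfold gdef; omega
  · have hk : numBlocks ρ γ ≤ numBlocks π γ + 1 :=
      (card_le_merge _ x y).trans
        (Nat.add_le_add_right (card_antitone (hle _ (le_merge _ x y) (merge_xy _ x y))) 1)
    have hb := numCycles_merge (γ * ρ⁻¹) x y (fun h => hJ (hτ h))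
    unfold gdef; omega

/-- `τ` is the first return map of `π` on `M`, extended by the identity. -/
def IsRet (τ π : Perm α) (M : Set α) : Prop :=
  (∀ z, z ∉ M → τ z = z) ∧
  ∀ z ∈ M, τ z ∈ M ∧ ∃ k : ℕ, 0 < k ∧ τ z = (π ^ k) z ∧ ∀ j, 0 < j → j < k → (π ^ j) z ∉ M

theorem isRet_univ (π : Perm α) : IsRet π π Set.univ :=
  ⟨fun z h => absurd (Set.mem_univ z) h, fun z _ => ⟨trivial, 1, one_pos, by simp, by omega⟩⟩

theorem isRet_step [DecidableEq α] {τ π : Perm α} {M : Set α} (h : IsRet τ π M) {x : α}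
    (hx : x ∈ M) : IsRet (swap x (τ x) * τ) π (M \ {x}) := by
  obtain ⟨h1, h2⟩ := h
  obtain ⟨hxM, k, hk, hkx, hkj⟩ := h2 x hx
  refine ⟨?_, ?_⟩
  · intro z hz
    by_cases hzx : z = x
    · subst hzx; simp
    have hzM : z ∉ M := fun h => hz ⟨h, hzx⟩
    rw [Perm.mul_apply, h1 z hzM, swap_apply_of_ne_of_ne hzx]
    rintro rfl; exact hzM hxM
  · rintro z ⟨hz, hzx⟩
    have hzx : z ≠ x := hzx
    obtain ⟨hzM, l, hl, hlz, hlj⟩ := h2 z hz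
    rw [Perm.mul_apply]
    by_cases hτ : τ z = x
    · rw [hτ, swap_apply_left]
      refine ⟨⟨hxM, fun h => ?_⟩, k + l, by omega, ?_, ?_⟩
      · have h : τ x = x := h
        exact hzx (τ.injective (hτ.trans h.symm))
      · rw [pow_add, Perm.mul_apply, ← hlz, hτ, hkx]
      · intro j hj hjl hjM
        rcases lt_trichotomy j l with hlt | heq | hgt
        · exact hlj j hj hlt hjM.1
        · subst heq; rw [← hlz, hτ] at hjM; exact hjM.2 rfl
        · obtain ⟨i, rfl⟩ := Nat.exists_eq_add_of_lt hgt
          rw [show l + i + 1 = (i + 1) + l by omega, pow_add, Perm.mul_apply, ← hlz, hτ] at hjM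
          exact hkj (i + 1) (by omega) (by omega) hjM.1
    · rw [swap_apply_of_ne_of_ne hτ (fun h => hzx (τ.injective h))]
      exact ⟨⟨hzM, hτ⟩, l, hl, hlz, fun j hj hjl hjM => hlj j hj hjl hjM.1⟩

theorem exists_ret [Finite α] (π γ : Perm α) (N : Finset α) :
    ∃ π' γ' : Perm α, IsRet π' π (↑N)ᶜ ∧ IsRet γ' γ (↑N)ᶜ ∧ gdef π' γ' ≤ gdef π γ := by
  classical
  induction N using Finset.induction_on with
  | empty => exact ⟨π, γ, by simpa using isRet_univ π, by simpa using isRet_univ γ, le_rfl⟩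
  | insert x N hx ih =>
    obtain ⟨π', γ', h1, h2, h3⟩ := ih
    have hM : ((↑(insert x N) : Set α))ᶜ = (↑N)ᶜ \ {x} := by
      ext z; simp [not_or, and_comm]
    have hxN : x ∈ ((↑N : Set α))ᶜ := by simpa using hx
    refine ⟨swap x (π' x) * π', swap x (γ' x) * γ', ?_, ?_, ?_⟩
    · rw [hM]; exact isRet_step h1 hxN
    · rw [hM]; exact isRet_step h2 hxN
    · refine (gdef_step π' _ x).trans ?_
      rw [gdef_symm]
      refine (gdef_step γ' _ x).trans ?_
      rw [gdef_symm]
      exact h3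

theorem join_self (τ : Perm α) : joinSetoid τ τ = sameCycleSetoid τ := sup_idem _

theorem numBlocks_self (τ : Perm α) : numBlocks τ τ = numCycles τ := by
  unfold numBlocks numCycles; rw [join_self]

theorem numBlocks_ofSubtype [Finite α] {p : α → Prop} [DecidablePred p]
    (e f : Perm {x // p x}) :
    numBlocks (Perm.ofSubtype e) (Perm.ofSubtype f) = numBlocks e f + Nat.card {x // ¬ p x} := by
  classical
  let F : α → Quotient (joinSetoid e f) ⊕ {x // ¬ p x} := fun z =>
    if h : p z then Sum.inl (Quotient.mk _ ⟨z, h⟩) else Sum.inr ⟨z, h⟩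
  have Fs : Function.Surjective F := by
    rintro (q | z)
    · induction q using Quotient.inductionOn with
      | h a => exact ⟨a.1, by simp [F, a.2]⟩
    · exact ⟨z.1, by simp [F, z.2]⟩
  have aux : ∀ (g : Perm {x // p x}), (∀ z, (joinSetoid e f).r (g z) z) →
      ∀ z, (Setoid.ker F).r (Perm.ofSubtype g z) z := by
    intro g hg z
    show F _ = F z
    by_cases hz : p z
    · rw [Perm.ofSubtype_apply_of_mem g hz]
      have h1 := (g ⟨z, hz⟩).2
      simp only [F, hz, h1, dif_pos]
      exact congrArg Sum.inl (Quotient.sound (hg ⟨z, hz⟩))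
    · rw [Perm.ofSubtype_apply_of_not_mem g hz]
  have hker : joinSetoid (Perm.ofSubtype e) (Perm.ofSubtype f) = Setoid.ker F := by
    refine le_antisymm (join_le (aux e (join_left e f)) (aux f (join_right e f))) ?_
    have hc : joinSetoid e f ≤
        Setoid.comap Subtype.val (joinSetoid (Perm.ofSubtype e) (Perm.ofSubtype f)) := by
      refine join_le ?_ ?_
      · intro z
        have := join_left (Perm.ofSubtype e) (Perm.ofSubtype f) z.1
        rw [Perm.ofSubtype_apply_coe] at this
        exact this
      · intro z
        have := join_right (Perm.ofSubtype e) (Perm.ofSubtype f) z.1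
        rw [Perm.ofSubtype_apply_coe] at this
        exact this
    intro a b hab
    have hab : F a = F b := hab
    by_cases ha : p a <;> by_cases hb : p b <;> simp only [F, ha, hb, dif_pos, dif_neg,
      not_false_eq_true, reduceCtorEq, Sum.inl.injEq, Sum.inr.injEq, Subtype.mk.injEq] at hab
    · exact hc (Quotient.exact hab)
    · subst hab; exact (joinSetoid _ _).refl _
  unfold numBlocks
  rw [hker, Nat.card_congr (Setoid.quotientKerEquivOfSurjective F Fs), Nat.card_sum]

theorem gdef_ofSubtype [Finite α] {p : α → Prop} [DecidablePred p] (e f : Perm {x // p x}) :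
    gdef (Perm.ofSubtype e) (Perm.ofSubtype f) = gdef e f := by
  have hn : ∀ g : Perm {x // p x},
      numCycles (Perm.ofSubtype g) = numCycles g + Nat.card {x // ¬ p x} := by
    intro g
    rw [← numBlocks_self, ← numBlocks_self, numBlocks_ofSubtype]
  have hc : Nat.card α = Nat.card {x // p x} + Nat.card {x // ¬ p x} := by
    rw [← Nat.card_sum, Nat.card_congr (Equiv.sumCompl p)]
  unfold gdef
  rw [← map_inv, ← map_mul, hn, hn, hn, numBlocks_ofSubtype, hc]
  push_cast; ring

theorem ofSubtype_restrict {τ π : Perm α} {M : Set α} [DecidablePred (· ∈ M)]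
    (h : IsRet τ π M) : Perm.ofSubtype (restrictPerm π (· ∈ M)) = τ := by
  have hfr : ∀ z ∈ M, firstReturn π (· ∈ M) z = τ z := by
    intro z hz
    obtain ⟨hm, k, hk, hkz, hj⟩ := h.2 z hz
    have : sInf {k : ℕ | 0 < k ∧ (π ^ k) z ∈ M} = k := by
      apply le_antisymm
      · exact Nat.sInf_le ⟨hk, hkz ▸ hm⟩
      · have hmem := Nat.sInf_mem (s := {k : ℕ | 0 < k ∧ (π ^ k) z ∈ M}) ⟨k, hk, hkz ▸ hm⟩
        by_contra hlt
        exact hj _ hmem.1 (not_le.1 hlt) hmem.2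
    unfold firstReturn
    rw [this, hkz]
  have hiff : ∀ z, τ z ∈ M ↔ z ∈ M := by
    intro z
    refine ⟨fun hz => ?_, fun hz => (h.2 z hz).1⟩
    by_contra hn
    rw [h.1 z hn] at hz
    exact hn hz
  have hex : ∃ e : Perm {x // x ∈ M}, ∀ x : {x // x ∈ M},
      (e x : α) = firstReturn π (· ∈ M) (x : α) :=
    ⟨τ.subtypePerm hiff, fun x => by rw [hfr x x.2]; rfl⟩
  have hspec : ∀ x : {x // x ∈ M}, (restrictPerm π (· ∈ M) x : α) = τ x := by
    intro x
    rw [← hfr x x.2]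
    unfold restrictPerm
    rw [dif_pos hex]
    exact hex.choose_spec x
  ext z
  by_cases hz : z ∈ M
  · rw [Perm.ofSubtype_apply_of_mem _ hz, hspec]
  · rw [Perm.ofSubtype_apply_of_not_mem _ hz, h.1 z hz]

theorem numCycles_one [Finite α] : numCycles (1 : Perm α) = Nat.card α := by
  unfold numCycles
  refine (Nat.card_congr (Equiv.ofBijective (Quotient.mk (sameCycleSetoid (1 : Perm α)))
    ⟨fun a b h => ?_, Quotient.mk_surjective⟩)).symm
  exact Perm.sameCycle_one.1 (Quotient.exact h)

theorem gdef_nonneg [Finite α] (π γ : Perm α) : 0 ≤ gdef π γ := by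
  have := Fintype.ofFinite α
  obtain ⟨π', γ', h1, h2, h3⟩ := exists_ret π γ Finset.univ
  have e1 : π' = 1 := Equiv.ext fun z => h1.1 z (by simp)
  have e2 : γ' = 1 := Equiv.ext fun z => h2.1 z (by simp)
  subst e1 e2
  refine le_trans (le_of_eq ?_) h3
  unfold gdef
  rw [numBlocks_self, inv_one, one_mul, numCycles_one]; ring

theorem numBlocks_of_joinTop [Nonempty α] {π γ : Perm α} (h : JoinTop π γ) :
    numBlocks π γ = 1 := by
  unfold numBlocks
  rw [Nat.card_eq_one_iff_unique]
  refine ⟨⟨fun a b => ?_⟩, ⟨Quotient.mk _ (Classical.arbitrary α)⟩⟩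
  induction a, b using Quotient.inductionOn₂ with
  | h a b => exact Quotient.sound (h a b)

theorem snc_restrict [Finite α] {γ σ : Perm α} (hσ : SNC γ σ) (M : Set α)
    (hM : ∀ x, ∃ y ∈ M, γ.SameCycle x y)
    (hjoin : JoinTop (restrictPerm σ (· ∈ M)) (restrictPerm γ (· ∈ M))) :
    SNC (restrictPerm γ (· ∈ M)) (restrictPerm σ (· ∈ M)) := by
  classical
  have := Fintype.ofFinite α
  have hne : Nonempty α := by
    by_contra hn
    rw [not_nonempty_iff] at hn
    have h2 := hσ.2
    unfold numCycles at h2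
    simp at h2
  obtain ⟨y, hy, -⟩ := hM (Classical.arbitrary α)
  have hneM : Nonempty {x // x ∈ M} := ⟨⟨y, hy⟩⟩
  refine ⟨hjoin, ?_⟩
  obtain ⟨π', γ', h1, h2, h3⟩ := exists_ret σ γ (Finset.univ.filter (· ∉ M))
  have hMM : (((Finset.univ.filter (· ∉ M) : Finset α) : Set α))ᶜ = M := by
    ext z; simp
  rw [hMM] at h1 h2
  rw [← ofSubtype_restrict h1, ← ofSubtype_restrict h2, gdef_ofSubtype] at h3
  have h0 := gdef_nonneg (restrictPerm σ (· ∈ M)) (restrictPerm γ (· ∈ M))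
  have hs := hσ.2
  have hb1 := numBlocks_of_joinTop hσ.1
  have hb2 := numBlocks_of_joinTop hjoin
  unfold gdef at h0 h3
  rw [hb2] at h0 h3
  rw [hb1] at h3
  omega

end Aux

/-- if `σ ∈ S_NC(m₁,…,m_r)`, `M` meets every cycle of `γ` and
`σ|_M ∨ γ|_M = 1_M`, then `σ|_M ∈ S_NC(γ|_M)`. -/
theorem stmt9 {r : ℕ} (m : Fin r → ℕ)
    (γ : Equiv.Perm ((i : Fin r) × Fin (m i))) (hγ : γ = blockRotate m)
    (σ : Equiv.Perm ((i : Fin r) × Fin (m i))) (hσ : SNC γ σ)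
    (M : Set ((i : Fin r) × Fin (m i)))
    (hM : ∀ x, ∃ y ∈ M, γ.SameCycle x y)
    (hjoin : JoinTop (restrictPerm σ (· ∈ M)) (restrictPerm γ (· ∈ M))) :
    SNC (restrictPerm γ (· ∈ M)) (restrictPerm σ (· ∈ M)) := by
  exact snc_restrict hσ M hM hjoin

end ThirdOrderFree
end

section
/- Let γ = γ_{m₁,…,m_r} ∈ S_m and σ ∈ S_NC(m₁,…,m_r). Let M ⊆ [m] intersect every cycle of γ. Then for every block B of the partition σ|_M ∨ γ|_M, the restriction σ|_B belongs to S_NC(γ|_B); i.e. σ|_M is a product over the blocks of σ|_M ∨ γ|_M of annular non-crossing permutations. -/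
open Equiv

namespace ThirdOrderFree

variable {α : Type*}

/-- number of classes -/
noncomputable def cls (s : Setoid α) : ℕ := Nat.card (Quotient s)

/-- merge the classes of `a` and `b` -/
def mergeS (s : Setoid α) (a b : α) : Setoid α where
  r x y := s x y ∨ (s x a ∧ s y b) ∨ (s x b ∧ s y a)
  iseqv := by
    refine ⟨fun x => Or.inl (s.refl x), ?_, ?_⟩
    · rintro x y (h | ⟨h, h'⟩ | ⟨h, h'⟩)
      · exact Or.inl (s.symm h)
      · exact Or.inr (Or.inr ⟨h', h⟩)
      · exact Or.inr (Or.inl ⟨h', h⟩)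
    · rintro x y z (h | ⟨h, h'⟩ | ⟨h, h'⟩) (g | ⟨g, g'⟩ | ⟨g, g'⟩)
      · exact Or.inl (s.trans h g)
      · exact Or.inr (Or.inl ⟨s.trans h g, g'⟩)
      · exact Or.inr (Or.inr ⟨s.trans h g, g'⟩)
      · exact Or.inr (Or.inl ⟨h, s.trans (s.symm g) h'⟩)
      · exact Or.inr (Or.inl ⟨h, g'⟩)
      · exact Or.inl (s.trans h (s.symm g'))
      · exact Or.inr (Or.inr ⟨h, s.trans (s.symm g) h'⟩)
      · exact Or.inl (s.trans h (s.symm g'))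
      · exact Or.inr (Or.inr ⟨h, g'⟩)

theorem mergeS_def (s : Setoid α) (a b x y : α) :
    mergeS s a b x y ↔ s x y ∨ (s x a ∧ s y b) ∨ (s x b ∧ s y a) := Iff.rfl

theorem le_mergeS (s : Setoid α) (a b : α) : s ≤ mergeS s a b := fun {_ _} h => Or.inl h

theorem mergeS_ab (s : Setoid α) (a b : α) : mergeS s a b a b :=
  Or.inr (Or.inl ⟨s.refl a, s.refl b⟩)

theorem mergeS_le {s t : Setoid α} {a b : α} (h : s ≤ t) (hab : t a b) : mergeS s a b ≤ t := by
  rintro x y (g | ⟨g, g'⟩ | ⟨g, g'⟩)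
  · exact h g
  · exact t.trans (h g) (t.trans hab (t.symm (h g')))
  · exact t.trans (h g) (t.trans (t.symm hab) (t.symm (h g')))

theorem cls_anti [Finite α] {s t : Setoid α} (h : s ≤ t) : cls t ≤ cls s := by
  apply Nat.card_le_card_of_surjective (Quotient.map' (s₁ := s) (s₂ := t) id fun _ _ g => h g)
  intro q
  induction q using Quotient.inductionOn with
  | _ x => exact ⟨Quotient.mk s x, rfl⟩

open Classical in
/-- the comparison map -/
noncomputable def mergeMap (s : Setoid α) (a b : α) : Quotient s → Option (Quotient (mergeS s a b)) :=
  fun q => if q = Quotient.mk s b then none else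
    some (Quotient.map' (s₁ := s) (s₂ := mergeS s a b) id (fun _ _ g => Or.inl g) q)

theorem mergeMap_mk (s : Setoid α) (a b x : α) (h : ¬ s x b) :
    mergeMap s a b (Quotient.mk s x) = some (Quotient.mk _ x) := by
  unfold mergeMap
  rw [if_neg]
  · rfl
  · intro e; exact h (Quotient.exact e)

theorem mergeMap_none (s : Setoid α) (a b x : α) (h : s x b) :
    mergeMap s a b (Quotient.mk s x) = none := by
  unfold mergeMap
  rw [if_pos]
  exact Quotient.sound h

theorem cls_le_merge [Finite α] (s : Setoid α) (a b : α) : cls s ≤ cls (mergeS s a b) + 1 := by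
  unfold cls
  rw [← Finite.card_option]
  apply Nat.card_le_card_of_injective (mergeMap s a b)
  intro q q'
  refine Quotient.inductionOn₂ q q' ?_
  intro x y h
  by_cases hx : s x b <;> by_cases hy : s y b
  · exact Quotient.sound (s.trans hx (s.symm hy))
  · rw [mergeMap_none _ _ _ _ hx, mergeMap_mk _ _ _ _ hy] at h; simp at h
  · rw [mergeMap_none _ _ _ _ hy, mergeMap_mk _ _ _ _ hx] at h; simp at h
  · rw [mergeMap_mk _ _ _ _ hx, mergeMap_mk _ _ _ _ hy] at h
    have := Quotient.exact (Option.some.inj h)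
    rcases this with g | ⟨g, g'⟩ | ⟨g, g'⟩
    · exact Quotient.sound g
    · exact absurd g' hy
    · exact absurd g hx

theorem merge_le_cls [Finite α] (s : Setoid α) (a b : α) (hab : ¬ s a b) :
    cls (mergeS s a b) + 1 ≤ cls s := by
  unfold cls
  rw [← Finite.card_option]
  apply Nat.card_le_card_of_surjective (mergeMap s a b)
  intro q
  rcases q with _ | q
  · exact ⟨Quotient.mk s b, mergeMap_none _ _ _ _ (s.refl b)⟩
  · induction q using Quotient.inductionOn with
    | _ x =>
      by_cases hx : s x b
      · refine ⟨Quotient.mk s a, ?_⟩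
        rw [mergeMap_mk _ _ _ _ hab]
        congr 1
        exact Quotient.sound (Or.inr (Or.inl ⟨s.refl a, hx⟩))
      · exact ⟨Quotient.mk s x, mergeMap_mk _ _ _ _ hx⟩

theorem cls_le_merge' [Finite α] (s : Setoid α) (a b : α) (hab : s a b) :
    cls s ≤ cls (mergeS s a b) := cls_anti (mergeS_le le_rfl hab)

theorem sc_le [Finite α] {τ : Perm α} {s : Setoid α} (h : ∀ y, s y (τ y)) :
    sameCycleSetoid τ ≤ s := by
  intro x y hxy
  obtain ⟨n, rfl⟩ := Equiv.Perm.SameCycle.exists_nat_pow_eq (f := τ) hxy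
  clear hxy
  induction n with
  | zero => exact s.refl _
  | succ n ih =>
    rw [pow_succ', Perm.mul_apply]
    exact s.trans ih (h _)

theorem sc_step (τ : Perm α) (y : α) : sameCycleSetoid τ y (τ y) :=
  (Perm.SameCycle.refl τ y).apply_right

theorem perm_app_inv (σ : Perm α) (x : α) : σ (σ⁻¹ x) = x := by simp

theorem numCycles_eq (τ : Perm α) : numCycles τ = cls (sameCycleSetoid τ) := rfl

theorem fix_of_sc {τ : Perm α} {x y : α} (hx : τ x = x) (h : sameCycleSetoid τ x y) : x = y := by
  obtain ⟨n, hn⟩ := h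
  rw [Perm.zpow_apply_eq_self_of_apply_eq_self hx] at hn
  exact hn

section
variable [DecidableEq α]

theorem swap_sc_le [Finite α] (τ : Perm α) (a b : α) {s : Setoid α} (h : sameCycleSetoid τ ≤ s)
    (hab : s a b) : sameCycleSetoid (swap a b * τ) ≤ s := by
  apply sc_le
  intro y
  rw [Perm.mul_apply]
  have h1 : s y (τ y) := h (sc_step τ y)
  by_cases ha : τ y = a
  · rw [ha, swap_apply_left]; rw [ha] at h1; exact s.trans h1 hab
  by_cases hb : τ y = b
  · rw [hb, swap_apply_right]; rw [hb] at h1; exact s.trans h1 (s.symm hab)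
  · rw [swap_apply_of_ne_of_ne ha hb]; exact h1

theorem swap_num_le [Finite α] (τ : Perm α) (a b : α) :
    numCycles τ ≤ numCycles (swap a b * τ) + 1 := by
  have h1 := cls_le_merge (sameCycleSetoid τ) a b
  have h2 := cls_anti (swap_sc_le τ a b (le_mergeS (sameCycleSetoid τ) a b) (mergeS_ab _ a b))
  simp only [numCycles_eq]; omega

theorem sc_le_swap [Finite α] (τ : Perm α) (a b : α)
    {s : Setoid α} (h : sameCycleSetoid (swap a b * τ) ≤ s)
    (hab : s a b) : sameCycleSetoid τ ≤ s := by
  have := swap_sc_le (swap a b * τ) a b h hab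
  rwa [swap_mul_self_mul] at this

theorem swap_join [Finite α] (τ : Perm α) (a b : α) (h : ¬ sameCycleSetoid τ a b) :
    sameCycleSetoid (swap a b * τ) b a := by
  have key : ∀ j : ℕ, sameCycleSetoid (swap a b * τ) b ((τ ^ j) b) := by
    intro j
    induction j with
    | zero => exact Setoid.refl' _ _
    | succ j ih =>
      have hne : τ ((τ ^ j) b) ≠ a := by
        intro e
        apply h
        apply Setoid.symm' _
        refine ⟨(j + 1 : ℕ), ?_⟩
        rw [zpow_natCast, pow_succ', Perm.mul_apply, e]
      rw [pow_succ', Perm.mul_apply]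
      by_cases hb : τ ((τ ^ j) b) = b
      · rw [hb]
      · have := sc_step (swap a b * τ) ((τ ^ j) b)
        rw [Perm.mul_apply, swap_apply_of_ne_of_ne hne hb] at this
        exact Setoid.trans' _ ih this
  have h1 : τ.SameCycle b (τ⁻¹ b) := ⟨-1, by simp⟩
  obtain ⟨n, hn⟩ := Equiv.Perm.SameCycle.exists_nat_pow_eq h1
  have h2 := key n
  rw [hn] at h2
  have := sc_step (swap a b * τ) (τ⁻¹ b)
  rw [Perm.mul_apply, perm_app_inv, swap_apply_right] at this
  exact Setoid.trans' _ h2 this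

theorem swap_num_lt [Finite α] (τ : Perm α) (a b : α) (h : ¬ sameCycleSetoid τ a b) :
    numCycles (swap a b * τ) + 1 ≤ numCycles τ := by
  have hj := swap_join τ a b h
  have h1 := merge_le_cls (sameCycleSetoid τ) a b h
  have h2 := cls_anti (mergeS_le (sc_le_swap τ a b le_rfl (Setoid.symm' _ hj)) (Setoid.symm' _ hj))
  simp only [numCycles_eq]; omega

/-- turn `x` into a fixed point -/
def iso (σ : Perm α) (x : α) : Perm α := swap x (σ x) * σ

theorem iso_self (σ : Perm α) (x : α) : iso σ x x = x := by simp [iso]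

theorem iso_num [Finite α] (σ : Perm α) (x : α) (h : σ x ≠ x) :
    numCycles σ + 1 ≤ numCycles (iso σ x) := by
  have : ¬ sameCycleSetoid (iso σ x) x (σ x) := fun e => h (fix_of_sc (iso_self σ x) e).symm
  have := swap_num_lt _ _ _ this
  rwa [iso, swap_mul_self_mul] at this

theorem iso_of_fix (σ : Perm α) (x : α) (h : σ x = x) : iso σ x = σ := by
  rw [iso, h, swap_self]; rfl

end

/-- the total genus defect -/
noncomputable def defect (σ γ : Perm α) : ℤ :=
  2 * (cls (joinSetoid σ γ) : ℤ) + (Nat.card α : ℤ) - numCycles σ - numCycles γ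
    - numCycles (σ⁻¹ * γ)

theorem join_left_s10 (σ γ : Perm α) : sameCycleSetoid σ ≤ joinSetoid σ γ := le_sup_left
theorem join_right_s10 (σ γ : Perm α) : sameCycleSetoid γ ≤ joinSetoid σ γ := le_sup_right

theorem kappa_le_join [Finite α] (σ γ : Perm α) :
    sameCycleSetoid (σ⁻¹ * γ) ≤ joinSetoid σ γ := by
  apply sc_le
  intro y
  have h1 := join_right_s10 σ γ (sc_step γ y)
  have h2 := join_left_s10 σ γ (sc_step σ (σ⁻¹ (γ y)))
  rw [perm_app_inv] at h2
  exact Setoid.trans' _ h1 (Setoid.symm' _ h2)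

theorem join_le_iso [Finite α] [DecidableEq α] (σ γ : Perm α) (x : α) :
    joinSetoid σ γ ≤ mergeS (mergeS (joinSetoid (iso σ x) (iso γ x)) x (σ x)) x (γ x) := by
  set J := joinSetoid (iso σ x) (iso γ x) with hJ
  apply sup_le
  · refine sc_le_swap σ x (σ x) ?_ ?_
    · exact ((join_left_s10 _ _).trans (le_mergeS J x (σ x))).trans (le_mergeS _ _ _)
    · exact le_mergeS _ _ _ (mergeS_ab J x (σ x))
  · refine sc_le_swap γ x (γ x) ?_ ?_
    · exact ((join_right_s10 _ _).trans (le_mergeS J x (σ x))).trans (le_mergeS _ _ _)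
    · exact mergeS_ab _ _ _

theorem kappa_iso [DecidableEq α] (σ γ : Perm α) (x : α) :
    (iso σ x)⁻¹ * iso γ x = σ⁻¹ * swap x (σ x) * swap x (γ x) * γ := by
  simp [iso, mul_assoc]

theorem defect_comm (σ γ : Perm α) : defect σ γ = defect γ σ := by
  have h : numCycles (σ⁻¹ * γ) = numCycles (γ⁻¹ * σ) := by
    have : sameCycleSetoid (σ⁻¹ * γ) = sameCycleSetoid (γ⁻¹ * σ) := by
      ext x y
      change (σ⁻¹ * γ).SameCycle x y ↔ (γ⁻¹ * σ).SameCycle x y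
      rw [← Perm.sameCycle_inv, mul_inv_rev, inv_inv]
    rw [numCycles, numCycles, this]
  have h2 : joinSetoid σ γ = joinSetoid γ σ := sup_comm _ _
  rw [defect, defect, h, h2]; ring

theorem defect_iso_fix [Finite α] [DecidableEq α] (σ γ : Perm α) (x : α) (hσ : σ x = x) :
    defect (iso σ x) (iso γ x) ≤ defect σ γ := by
  by_cases hγ : γ x = x
  · rw [iso_of_fix _ _ hσ, iso_of_fix _ _ hγ]
  have h1 := iso_num γ x hγ
  have hk : (iso σ x)⁻¹ * iso γ x = iso (σ⁻¹ * γ) x := by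
    rw [kappa_iso, hσ, swap_self]
    have : σ⁻¹ x = x := by rw [Perm.inv_eq_iff_eq, hσ]
    rw [iso, ← mul_assoc, Perm.mul_apply]
    congr 1
    have h3 := Equiv.mul_swap_eq_swap_mul σ⁻¹ x (γ x)
    rw [this] at h3
    rw [← h3]; ext; simp
  have hκ : (σ⁻¹ * γ) x ≠ x := by
    intro e
    rw [Perm.mul_apply, Perm.inv_eq_iff_eq, hσ] at e
    exact hγ e
  have h2 := iso_num (σ⁻¹ * γ) x hκ
  rw [← hk] at h2
  have hJ := cls_anti (join_le_iso σ γ x)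
  have a1 := cls_le_merge (mergeS (joinSetoid (iso σ x) (iso γ x)) x (σ x)) x (γ x)
  have a2 := cls_le_merge' (joinSetoid (iso σ x) (iso γ x)) x (σ x) (by rw [hσ])
  rw [iso_of_fix _ _ hσ] at *
  unfold defect
  omega

theorem defect_iso [Finite α] [DecidableEq α] (σ γ : Perm α) (x : α) :
    defect (iso σ x) (iso γ x) ≤ defect σ γ := by
  by_cases hσ : σ x = x
  · exact defect_iso_fix σ γ x hσ
  by_cases hγ : γ x = x
  · rw [defect_comm, defect_comm σ]; exact defect_iso_fix γ σ x hγ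
  have n1 := iso_num σ x hσ
  have n2 := iso_num γ x hγ
  have hJ := cls_anti (join_le_iso σ γ x)
  have a1 := cls_le_merge (mergeS (joinSetoid (iso σ x) (iso γ x)) x (σ x)) x (γ x)
  have a1' := cls_le_merge' (mergeS (joinSetoid (iso σ x) (iso γ x)) x (σ x)) x (γ x)
  have a2 := cls_le_merge (joinSetoid (iso σ x) (iso γ x)) x (σ x)
  by_cases he : σ x = γ x
  · have a3 := a1' (by rw [← he]; exact mergeS_ab _ _ _)
    have hk : (iso σ x)⁻¹ * iso γ x = σ⁻¹ * γ := by
      rw [kappa_iso, ← he, mul_assoc σ⁻¹, swap_mul_self, mul_one]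
    unfold defect
    rw [hk]
    omega
  -- the generic case
  set a := σ⁻¹ x with ha
  set k := σ⁻¹ (γ x) with hkdef
  have hak : swap a k * ((iso σ x)⁻¹ * iso γ x) = iso (σ⁻¹ * γ) x := by
    have e1 : σ⁻¹ * swap x (σ x) = swap a x * σ⁻¹ := by
      rw [Equiv.mul_swap_eq_swap_mul]; simp [ha]
    have e2 : σ⁻¹ * swap x (γ x) = swap a k * σ⁻¹ := by
      rw [Equiv.mul_swap_eq_swap_mul]
    rw [kappa_iso, e1, mul_assoc (swap a x), e2, iso, Perm.mul_apply, ← hkdef]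
    simp only [← mul_assoc]
    congr 2
    have hax : a ≠ x := by
      intro e; apply hσ; rw [ha, Perm.inv_eq_iff_eq] at e; exact e.symm
    have hkx : k ≠ x := by
      intro e; apply he; rw [hkdef, Perm.inv_eq_iff_eq] at e; exact e.symm
    have hka : k ≠ a := by
      intro e; exact hγ (σ⁻¹.injective e)
    rw [mul_assoc]
    have := Equiv.swap_mul_swap_mul_swap (x := x) (y := a) (z := k) hax.symm hkx.symm
    ext z
    simp only [Perm.mul_apply, swap_apply_def]
    grind
  have hκ : (σ⁻¹ * γ) x ≠ x := by
    intro e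
    rw [Perm.mul_apply, Perm.inv_eq_iff_eq] at e
    exact he e.symm
  have n3 := iso_num (σ⁻¹ * γ) x hκ
  rw [← hak] at n3
  by_cases hrel : joinSetoid (iso σ x) (iso γ x) (σ x) (γ x)
  · have a3 := a1' (Setoid.trans' _ (mergeS_ab _ _ _) (le_mergeS _ _ _ hrel))
    have n4 := swap_num_le (swap a k * ((iso σ x)⁻¹ * iso γ x)) a k
    rw [swap_mul_self_mul] at n4
    unfold defect
    omega
  · have hna : ¬ sameCycleSetoid ((iso σ x)⁻¹ * iso γ x) a k := by
      intro e
      apply hrel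
      have e' := kappa_le_join _ _ e
      have b1 := join_left_s10 (iso σ x) (iso γ x) (sc_step (iso σ x) a)
      have b2 := join_left_s10 (iso σ x) (iso γ x) (sc_step (iso σ x) k)
      have c1 : iso σ x a = σ x := by simp [iso, ha]
      have c2 : iso σ x k = γ x := by
        rw [iso, Perm.mul_apply, hkdef, perm_app_inv,
          swap_apply_of_ne_of_ne hγ (fun h => he h.symm)]
      rw [c1] at b1
      rw [c2] at b2
      exact Setoid.trans' _ (Setoid.symm' _ b1) (Setoid.trans' _ e' b2)
    have n4 := swap_num_lt _ _ _ hna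
    unfold defect
    omega

/-- `σ'` is the first return permutation of `σ` off `S`, extended by fixed points. -/
def Ret (S : Finset α) (σ σ' : Perm α) : Prop :=
  (∀ x ∈ S, σ' x = x) ∧ ∀ x, x ∉ S → ∃ k, 0 < k ∧ σ' x = (σ ^ k) x ∧ (σ ^ k) x ∉ S ∧
    ∀ j, 0 < j → j < k → (σ ^ j) x ∈ S

theorem Ret.insert [DecidableEq α] {S : Finset α} {σ σ' : Perm α} (h : Ret S σ σ') {a : α}
    (ha : a ∉ S) : Ret (Insert.insert a S) σ (iso σ' a) := by
  obtain ⟨h1, h2⟩ := h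
  constructor
  · intro x hx
    rcases Finset.mem_insert.1 hx with rfl | hx
    · exact iso_self _ _
    · have hxa : x ≠ a := fun e => ha (e ▸ hx)
      have := h1 x hx
      rw [iso, Perm.mul_apply, this]
      apply swap_apply_of_ne_of_ne hxa
      intro e
      rw [← this] at e
      exact hxa (σ'.injective e)
  · intro x hx
    have hxa : x ≠ a := fun e => hx (by simp [e])
    have hxS : x ∉ S := fun e => hx (by simp [e])
    obtain ⟨k, k0, k1, k2, k3⟩ := h2 x hxS
    by_cases hc : σ' x = a
    · obtain ⟨l, l0, l1, l2, l3⟩ := h2 a ha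
      have hadd : ∀ i, (σ ^ (i + k)) x = (σ ^ i) a := by
        intro i
        rw [pow_add, Perm.mul_apply, ← k1, hc]
      refine ⟨l + k, by omega, ?_, ?_, ?_⟩
      · rw [hadd, ← l1, iso, Perm.mul_apply, hc, swap_apply_left]
      · rw [hadd]
        intro hm
        rcases Finset.mem_insert.1 hm with hm | hm
        · rw [← l1] at hm
          exact hxa (σ'.injective (hc.trans hm.symm))
        · exact l2 hm
      · intro j j0 j1
        rw [Finset.mem_insert]
        rcases lt_trichotomy j k with hj | rfl | hj
        · exact Or.inr (k3 j j0 hj)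
        · left; rw [← k1, hc]
        · right
          obtain ⟨i, rfl⟩ : ∃ i, j = i + k := ⟨j - k, by omega⟩
          rw [hadd]
          exact l3 i (by omega) (by omega)
    · refine ⟨k, k0, ?_, ?_, ?_⟩
      · rw [iso, Perm.mul_apply, ← k1, swap_apply_of_ne_of_ne hc]
        exact fun e => hxa (σ'.injective e)
      · intro hm
        rcases Finset.mem_insert.1 hm with hm | hm
        · exact hc (k1.trans hm)
        · exact k2 hm
      · intro j j0 j1
        exact Finset.mem_insert_of_mem (k3 j j0 j1)

theorem exists_ret_s10 [Finite α] (S : Finset α) (σ γ : Perm α) :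
    ∃ σ' γ', Ret S σ σ' ∧ Ret S γ γ' ∧ defect σ' γ' ≤ defect σ γ := by
  classical
  induction S using Finset.induction_on with
  | empty =>
    refine ⟨σ, γ, ⟨by simp, fun x _ => ⟨1, by simp; omega⟩⟩,
      ⟨by simp, fun x _ => ⟨1, by simp; omega⟩⟩, le_rfl⟩
  | insert a S ha ih =>
    obtain ⟨σ', γ', h1, h2, h3⟩ := ih
    exact ⟨_, _, h1.insert ha, h2.insert ha, (defect_iso _ _ _).trans h3⟩

theorem restrictPerm_eq {σ : Perm α} {p : α → Prop} (e : Perm {x // p x})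
    (he : ∀ x : {x // p x}, (e x : α) = firstReturn σ p (x : α)) : restrictPerm σ p = e := by
  have hex : ∃ e : Perm {x // p x}, ∀ x : {x // p x}, (e x : α) = firstReturn σ p (x : α) :=
    ⟨e, he⟩
  rw [restrictPerm, dif_pos hex]
  ext x
  rw [hex.choose_spec x, he x]

theorem restrictPerm_of {σ σ' : Perm α} {p : α → Prop} (hp : ∀ x, p (σ' x) ↔ p x)
    (h : ∀ x, p x → ∃ k, 0 < k ∧ σ' x = (σ ^ k) x ∧ ∀ j, 0 < j → j < k → ¬ p ((σ ^ j) x)) :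
    restrictPerm σ p = σ'.subtypePerm hp := by
  apply restrictPerm_eq
  rintro ⟨x, hx⟩
  obtain ⟨k, k0, k1, k2⟩ := h x hx
  change σ' x = firstReturn σ p x
  have : IsLeast {k : ℕ | 0 < k ∧ p ((σ ^ k) x)} k := by
    refine ⟨⟨k0, by rw [← k1, hp]; exact hx⟩, ?_⟩
    rintro j ⟨j0, j1⟩
    by_contra hlt
    exact k2 j j0 (by omega) j1
  rw [firstReturn, this.csInf_eq, k1]

theorem sc_subtype (σ : Perm α) {p : α → Prop} (hp : ∀ x, p (σ x) ↔ p x) :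
    sameCycleSetoid (σ.subtypePerm hp) = (sameCycleSetoid σ).comap Subtype.val := by
  ext x y
  exact Perm.sameCycle_subtypePerm

theorem join_subtype (σ γ : Perm α) {p : α → Prop} (hp : ∀ x, p (σ x) ↔ p x)
    (hq : ∀ x, p (γ x) ↔ p x) :
    joinSetoid (σ.subtypePerm hp) (γ.subtypePerm hq) = (joinSetoid σ γ).comap Subtype.val := by
  apply le_antisymm
  · apply sup_le
    · rw [sc_subtype]; exact fun {_ _} h => join_left_s10 σ γ h
    · rw [sc_subtype]; exact fun {_ _} h => join_right_s10 σ γ h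
  · have hinv : ∀ (τ : Perm α), (∀ x, p (τ x) ↔ p x) → ∀ x y, τ.SameCycle x y → (p x ↔ p y) := by
      intro τ hτ x y ⟨n, hn⟩
      rw [← hn]
      have := ((τ.subtypePerm hτ) ^ n)
      constructor
      · intro hx
        have h := (((τ.subtypePerm hτ) ^ n) ⟨x, hx⟩).2
        rwa [Perm.subtypePerm_zpow, Perm.subtypePerm_apply] at h
      · intro hx
        have h := (((τ.subtypePerm hτ) ^ (-n)) ⟨_, hx⟩).2
        rw [Perm.subtypePerm_zpow, Perm.subtypePerm_apply] at h
        simpa using h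
    -- the auxiliary setoid on the ambient type
    let J := joinSetoid (σ.subtypePerm hp) (γ.subtypePerm hq)
    let T : Setoid α := 
      { r := fun x y => (p x ↔ p y) ∧ ∀ (hx : p x) (hy : p y), J ⟨x, hx⟩ ⟨y, hy⟩
        iseqv := ⟨fun x => ⟨Iff.rfl, fun hx _ => J.refl _⟩,
          fun h => ⟨h.1.symm, fun hx hy => J.symm (h.2 hy hx)⟩,
          fun h g => ⟨h.1.trans g.1, fun hx hz => J.trans (h.2 hx (h.1.1 hx)) (g.2 (h.1.1 hx) hz)⟩⟩ }
    have hT : joinSetoid σ γ ≤ T := by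
      apply sup_le
      · intro x y hxy
        refine ⟨hinv σ hp x y hxy, fun hx hy => ?_⟩
        apply join_left_s10
        rw [sc_subtype]; exact hxy
      · intro x y hxy
        refine ⟨hinv γ hq x y hxy, fun hx hy => ?_⟩
        apply join_right_s10
        rw [sc_subtype]; exact hxy
    rintro ⟨x, hx⟩ ⟨y, hy⟩ h
    exact (hT h).2 hx hy

theorem cls_subtype [Finite α] (s : Setoid α) (p : α → Prop)
    (h : ∀ x y, ¬ p x → s x y → x = y) :
    cls s = cls (s.comap (Subtype.val : {x // p x} → α)) + Nat.card {x // ¬ p x} := by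
  unfold cls
  rw [← Nat.card_sum]
  symm
  let f : Quotient (s.comap (Subtype.val : {x // p x} → α)) ⊕ {x // ¬ p x} → Quotient s :=
    Sum.elim (Quotient.map' (s₂ := s) Subtype.val fun _ _ g => g) (fun x => Quotient.mk s x.1)
  apply Nat.card_eq_of_bijective f
  constructor
  · rintro (q | ⟨x, hx⟩) (q' | ⟨y, hy⟩)
    · refine Quotient.inductionOn₂ q q' ?_
      intro x y e
      have e' : s x y := Quotient.exact e
      congr 1
      exact Quotient.sound e'
    · refine Quotient.inductionOn q ?_
      intro x e
      have e' : s x y := Quotient.exact e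
      have := h y x hy (s.symm e')
      exact absurd x.2 (this ▸ hy)
    · refine Quotient.inductionOn q' ?_
      intro y e
      have e' : s x y := Quotient.exact e
      have := h x y hx e'
      exact absurd y.2 (this ▸ hx)
    · intro e
      have e' : s x y := Quotient.exact e
      have := h x y hx e'
      subst this
      rfl
  · intro q
    refine Quotient.inductionOn q ?_
    intro x
    by_cases hx : p x
    · exact ⟨Sum.inl (Quotient.mk _ ⟨x, hx⟩), rfl⟩
    · exact ⟨Sum.inr ⟨x, hx⟩, rfl⟩

theorem defect_subtype [Finite α] (σ γ : Perm α) {p : α → Prop} (hp : ∀ x, p (σ x) ↔ p x)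
    (hq : ∀ x, p (γ x) ↔ p x) (hσ : ∀ x, ¬ p x → σ x = x) (hγ : ∀ x, ¬ p x → γ x = x) :
    defect (σ.subtypePerm hp) (γ.subtypePerm hq) = defect σ γ := by
  have hκ : ∀ x, ¬ p x → (σ⁻¹ * γ) x = x := by
    intro x hx
    rw [Perm.mul_apply, hγ x hx, Perm.inv_eq_iff_eq, hσ x hx]
  have hr : ∀ x, p ((σ⁻¹ * γ) x) ↔ p x := by
    intro x
    rw [← hp ((σ⁻¹ * γ) x), Perm.mul_apply, perm_app_inv, hq]
  have ek : (σ.subtypePerm hp)⁻¹ * γ.subtypePerm hq = (σ⁻¹ * γ).subtypePerm hr := by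
    rw [inv_mul_eq_iff_eq_mul]
    ext x
    simp
  have c1 := cls_subtype (sameCycleSetoid σ) p (fun x y hx => fix_of_sc (hσ x hx))
  have c2 := cls_subtype (sameCycleSetoid γ) p (fun x y hx => fix_of_sc (hγ x hx))
  have c3 := cls_subtype (sameCycleSetoid (σ⁻¹ * γ)) p (fun x y hx => fix_of_sc (hκ x hx))
  have c4 := cls_subtype (joinSetoid σ γ) p (by
    intro x y hx
    let T : Setoid α :=
      { r := fun x y => x = y ∨ (p x ∧ p y)
        iseqv := ⟨fun _ => Or.inl rfl, by grind, by grind⟩ }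
    have hT : ∀ τ : Perm α, (∀ x, p (τ x) ↔ p x) → (∀ x, ¬ p x → τ x = x) →
        sameCycleSetoid τ ≤ T := by
      intro τ h1 h2
      apply sc_le
      intro z
      change z = τ z ∨ (p z ∧ p (τ z))
      by_cases hz : p z
      · exact Or.inr ⟨hz, (h1 z).2 hz⟩
      · exact Or.inl (h2 z hz).symm
    intro hxy
    have : T x y := (sup_le (hT σ hp hσ) (hT γ hq hγ) : joinSetoid σ γ ≤ T) hxy
    rcases this with e | ⟨e, _⟩
    · exact e
    · exact absurd e hx)
  have c5 : Nat.card α = Nat.card {x // p x} + Nat.card {x // ¬ p x} := by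
    classical
    rw [← Nat.card_sum]
    exact Nat.card_congr (Equiv.sumCompl p).symm
  unfold defect
  simp only [numCycles_eq, ek, join_subtype, sc_subtype]
  omega

theorem defect_restrict [Finite α] (σ γ : Perm α) (p : α → Prop) :
    defect (restrictPerm σ p) (restrictPerm γ p) ≤ defect σ γ := by
  classical
  have := Fintype.ofFinite α
  obtain ⟨σ', γ', h1, h2, h3⟩ := exists_ret_s10 (Finset.univ.filter fun x => ¬ p x) σ γ
  have key : ∀ τ τ' : Perm α, Ret (Finset.univ.filter fun x => ¬ p x) τ τ' →
      (∀ x, ¬ p x → τ' x = x) ∧ ∃ hp : ∀ x, p (τ' x) ↔ p x,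
        restrictPerm τ p = τ'.subtypePerm hp := by
    intro τ τ' ⟨g1, g2⟩
    simp only [Finset.mem_filter, Finset.mem_univ, true_and, not_not] at g1 g2
    have hp : ∀ x, p (τ' x) ↔ p x := by
      intro x
      by_cases hx : p x
      · obtain ⟨k, -, k1, k2, -⟩ := g2 x hx
        rw [k1]; exact ⟨fun _ => hx, fun _ => k2⟩
      · rw [g1 x hx]
    refine ⟨g1, hp, restrictPerm_of hp ?_⟩
    intro x hx
    obtain ⟨k, k0, k1, k2, k3⟩ := g2 x hx
    exact ⟨k, k0, k1, k3⟩
  obtain ⟨e1, hp, e2⟩ := key σ σ' h1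
  obtain ⟨f1, hq, f2⟩ := key γ γ' h2
  rw [e2, f2, defect_subtype σ' γ' hp hq e1 f1]
  exact h3

theorem defect_nonneg [Finite α] (σ γ : Perm α) : 0 ≤ defect σ γ := by
  refine le_trans (le_of_eq ?_) (defect_restrict σ γ (fun _ => False))
  have : IsEmpty {x : α // False} := ⟨fun x => x.2⟩
  simp [defect, cls, numCycles]

theorem cls_of_top (s : Setoid α) (x : α) (h : ∀ x y, s x y) : cls s = 1 := by
  unfold cls
  rw [Nat.card_eq_one_iff_unique]
  refine ⟨⟨fun q q' => ?_⟩, ⟨Quotient.mk s x⟩⟩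
  exact Quotient.inductionOn₂ q q' fun a b => Quotient.sound (h a b)

theorem ncRel_of_defect [Finite α] (σ γ : Perm α) (h : defect σ γ ≤ 0) : ncRel σ γ := by
  intro x
  have hd := (defect_restrict σ γ ((joinSetoid σ γ).r x)).trans h
  have hd' := defect_nonneg (restrictPerm σ ((joinSetoid σ γ).r x))
    (restrictPerm γ ((joinSetoid σ γ).r x))
  have hinv : ∀ τ : Perm α, sameCycleSetoid τ ≤ joinSetoid σ γ →
      ∀ y, (joinSetoid σ γ).r x (τ y) ↔ (joinSetoid σ γ).r x y := by
    intro τ hτ y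
    have := hτ (sc_step τ y)
    exact ⟨fun g => Setoid.trans' _ g (Setoid.symm' _ this), fun g => Setoid.trans' _ g this⟩
  have hp := hinv σ (join_left_s10 σ γ)
  have hq := hinv γ (join_right_s10 σ γ)
  have e1 : restrictPerm σ ((joinSetoid σ γ).r x) = σ.subtypePerm hp :=
    restrictPerm_of hp fun y _ => ⟨1, by simp; omega⟩
  have e2 : restrictPerm γ ((joinSetoid σ γ).r x) = γ.subtypePerm hq :=
    restrictPerm_of hq fun y _ => ⟨1, by simp; omega⟩
  have hjt : JoinTop (restrictPerm σ ((joinSetoid σ γ).r x))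
      (restrictPerm γ ((joinSetoid σ γ).r x)) := by
    intro y z
    rw [e1, e2, join_subtype]
    exact Setoid.trans' (joinSetoid σ γ) (Setoid.symm' _ y.2) z.2
  refine ⟨hjt, ?_⟩
  have hc := cls_of_top _ (⟨x, Setoid.refl' _ x⟩ : {y // (joinSetoid σ γ).r x y}) hjt
  unfold defect at hd hd'
  rw [hc] at hd hd'
  omega

/-- if `σ ∈ S_NC(m₁,…,m_r)` and `M` meets every cycle of `γ`, then on
every block `B` of `σ|_M ∨ γ|_M` the restriction `σ|_B` lies in `S_NC(γ|_B)`. -/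
theorem stmt10 {r : ℕ} (m : Fin r → ℕ)
    (γ : Equiv.Perm ((i : Fin r) × Fin (m i))) (hγ : γ = blockRotate m)
    (σ : Equiv.Perm ((i : Fin r) × Fin (m i))) (hσ : SNC γ σ)
    (M : Set ((i : Fin r) × Fin (m i)))
    (hM : ∀ x, ∃ y ∈ M, γ.SameCycle x y) :
    ncRel (restrictPerm σ (· ∈ M)) (restrictPerm γ (· ∈ M)) := by
  by_cases hne : Nonempty ((i : Fin r) × Fin (m i))
  · obtain ⟨x⟩ := hne
    apply ncRel_of_defect
    refine (defect_restrict σ γ (· ∈ M)).trans ?_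
    obtain ⟨h1, h2⟩ := hσ
    have hc := cls_of_top (joinSetoid σ γ) x h1
    unfold defect
    rw [hc]
    omega
  · intro x
    exact absurd ⟨x.1⟩ hne

end ThirdOrderFree
end
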